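/- In any rotor-router execution, for every i ≥ 0 and every time t, the i-th potential is non-increasing: Φ_i(S_{t+1}) ≤ Φ_i(S_t). -/

import Mathlib

open Finset

namespace RotorRouter

variable {V : Type} [Fintype V] [DecidableEq V] (G : SimpleGraph V) [DecidableRel G.Adj]

/-- The outgoing arcs (darts) of a vertex `v`. -/
def outArcs (v : V) : Finset G.Dart := Finset.univ.filter (fun d => d.fst = v)

/-- The incoming arcs (darts) of a vertex `v`. -/
def inArcs (v : V) : Finset G.Dart := Finset.univ.filter (fun d => d.snd = v)

/-- A state of the rotor-router system: at each vertex, the current pointer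
(represented as an index, in the fixed cyclic order, of an outgoing arc) and the
number of tokens currently located at the vertex. -/
structure State where
  ptr : V → ℕ
  tokens : V → ℕ
  ptr_lt : ∀ v : V, 0 < G.degree v → ptr v < G.degree v

variable (ord : ∀ v : V, Fin (G.degree v) ≃ {d : G.Dart // d.fst = v})

/-- The number of tokens sent out on the `j`-th outgoing arc when `k` tokens leave a
vertex of degree `deg` in round-robin fashion, starting from pointer position `p`. -/
def sentCount (deg p k j : ℕ) : ℕ :=
  ((Finset.range k).filter (fun i => (p + i) % deg = j)).card

/-- The number of tokens sent along the arc `d` during one step from state `S`. -/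
def arcLoad (S : State G) (d : G.Dart) : ℕ :=
  sentCount (G.degree d.fst) (S.ptr d.fst) (S.tokens d.fst)
    (((ord d.fst).symm ⟨d, rfl⟩ : Fin (G.degree d.fst)) : ℕ)

/-- One synchronous step of the rotor-router system: every vertex sends out all of its
tokens in round-robin fashion, advancing its pointer after each token. -/
def step (S : State G) : State G where
  ptr v := if 0 < G.degree v then (S.ptr v + S.tokens v) % G.degree v else S.ptr v
  tokens v := (∑ d ∈ inArcs G v, arcLoad G ord S d) +
    (if 0 < G.degree v then 0 else S.tokens v)
  ptr_lt v h := by simp only [if_pos h]; exact Nat.mod_lt _ h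

/-- `evol S0 t` is the state `S_t` reached after `t` steps from the initial state `S0`. -/
def evol (S0 : State G) (t : ℕ) : State G := (step G ord)^[t] S0

/-- `load S0 t d` is `L_t(d)`, the number of tokens sent along arc `d` during step `t`. -/
def load (S0 : State G) (t : ℕ) (d : G.Dart) : ℕ := arcLoad G ord (evol G ord S0 t) d

/-- `cum S0 t1 t2 d` is the cumulative load `C_{t1}^{t2}(d) = Σ_{t1 ≤ t < t2} L_t(d)`. -/
def cum (S0 : State G) (t1 t2 : ℕ) (d : G.Dart) : ℕ :=
  ∑ t ∈ Finset.Ico t1 t2, load G ord S0 t d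

/-- `cumV S0 t1 t2 v` is the cumulative vertex load `C_{t1}^{t2}(v)`. -/
def cumV (S0 : State G) (t1 t2 : ℕ) (v : V) : ℕ :=
  ∑ t ∈ Finset.Ico t1 t2, (evol G ord S0 t).tokens v

/-- `pot S0 i t` is the `i`-th potential `Φ_i(S_t) = Σ_{e} (C_t^{t+i}(e))²`. -/
def pot (S0 : State G) (i t : ℕ) : ℕ := ∑ d : G.Dart, (cum G ord S0 t (t + i) d) ^ 2

/-- A state `S_t` is stable if it repeats: `S_{t'} = S_t` for some `t' > t`. -/
def IsStable (S0 : State G) (t : ℕ) : Prop :=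
  ∃ t' > t, evol G ord S0 t' = evol G ord S0 t

/-- A family of bijections `in(v) → out(v)` (encoded as a global bijection `M` on darts
with `(M d).fst = d.snd`) is valid w.r.t. the `Δt`-step subcycle decomposition of `S_T`
if `L_t(e) = L_{t+1}(M e)` for all arcs `e` and all `T ≤ t < T + Δt`. -/
def ValidMapping (S0 : State G) (T Δt : ℕ) (M : G.Dart → G.Dart) : Prop :=
  Function.Bijective M ∧ (∀ d : G.Dart, (M d).fst = d.snd) ∧
    ∀ (d : G.Dart) (t : ℕ), T ≤ t → t < T + Δt →
      load G ord S0 t d = load G ord S0 (t + 1) (M d)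

/-- `S_T` admits a `Δt`-step subcycle decomposition. -/
def HasSubcycleDecomp (S0 : State G) (T Δt : ℕ) : Prop :=
  ∃ M : G.Dart → G.Dart, ValidMapping G ord S0 T Δt M


/-- A round-robin over `deg` slots is balanced: each slot receives `k / deg` or one more. -/
lemma sentCount_eq_or (deg p k j : ℕ) (hj : j < deg) :
    sentCount deg p k j = k / deg ∨ sentCount deg p k j = k / deg + 1 := by
  obtain ⟨e, rfl⟩ : ∃ e, deg = e + 1 := ⟨deg - 1, by omega⟩
  have key : sentCount (e + 1) p k j = k.count (· ≡ j + p * e [MOD (e + 1)]) := by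
    rw [Nat.count_eq_card_filter_range, sentCount]
    congr 1
    refine Finset.filter_congr fun i _ => ?_
    have hmod : p + (j + p * e) ≡ j [MOD (e + 1)] := by
      have : p + (j + p * e) = j + p * (e + 1) := by ring
      rw [this, Nat.ModEq, Nat.add_mul_mod_self_right]
    constructor
    · intro h
      have h' : p + i ≡ j [MOD (e + 1)] := by
        rw [Nat.ModEq, h, Nat.mod_eq_of_lt hj]
      exact Nat.ModEq.add_left_cancel' p (h'.trans hmod.symm)
    · intro h
      have h' := (Nat.ModEq.add_left p h).trans hmod
      rwa [Nat.ModEq, Nat.mod_eq_of_lt hj] at h'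
  rw [key, Nat.count_modEq_card _ (Nat.succ_pos e)]
  split_ifs <;> simp

/-- Sending `k + l` tokens amounts to sending `k` tokens, advancing the pointer, and then
sending `l` tokens. -/
lemma sentCount_add (deg p k l j : ℕ) :
    sentCount deg p (k + l) j = sentCount deg p k j + sentCount deg ((p + k) % deg) l j := by
  simp only [sentCount, Finset.card_filter, Finset.sum_range_add, Nat.mod_add_mod, add_assoc]

/-- Every token is sent to exactly one slot. -/
lemma sum_sentCount (deg p k : ℕ) (h : 0 < deg) :
    ∑ j : Fin deg, sentCount deg p k j = k := by
  rw [Fin.sum_univ_eq_sum_range (fun j => sentCount deg p k j) deg]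
  simp only [sentCount]
  rw [← Finset.card_eq_sum_card_fiberwise, Finset.card_range]
  intro i _
  simpa using Nat.mod_lt _ h

lemma evol_succ (S0 : State G) (t : ℕ) :
    evol G ord S0 (t + 1) = step G ord (evol G ord S0 t) :=
  Function.iterate_succ_apply' _ _ _

/-- The pointer at time `t + i` is determined by the number of tokens sent since time `t`. -/
lemma ptr_evol_add (S0 : State G) (t i : ℕ) (v : V) (hv : 0 < G.degree v) :
    (evol G ord S0 (t + i)).ptr v =
      ((evol G ord S0 t).ptr v + cumV G ord S0 t (t + i) v) % G.degree v := by
  induction i with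
  | zero => simp [cumV, Nat.mod_eq_of_lt ((evol G ord S0 t).ptr_lt v hv)]
  | succ i ih =>
    rw [← add_assoc, evol_succ, cumV, Finset.sum_Ico_succ_top (by omega)]
    simp only [step, if_pos hv, ih, cumV, Nat.mod_add_mod, add_assoc]

/-- The cumulative load of an arc is that of a single round-robin sending all the tokens
that leave its source during the time interval. -/
lemma cum_eq_sentCount (S0 : State G) (t i : ℕ) (d : G.Dart) :
    cum G ord S0 t (t + i) d =
      sentCount (G.degree d.fst) ((evol G ord S0 t).ptr d.fst)
        (cumV G ord S0 t (t + i) d.fst) ((ord d.fst).symm ⟨d, rfl⟩ : Fin (G.degree d.fst)) := by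
  induction i with
  | zero => simp [cum, cumV, sentCount]
  | succ i ih =>
    have hV : cumV G ord S0 t (t + i + 1) d.fst =
        cumV G ord S0 t (t + i) d.fst + (evol G ord S0 (t + i)).tokens d.fst :=
      Finset.sum_Ico_succ_top (by omega) _
    have hC : cum G ord S0 t (t + i + 1) d =
        cum G ord S0 t (t + i) d + load G ord S0 (t + i) d :=
      Finset.sum_Ico_succ_top (by omega) _
    rw [← add_assoc, hV, hC, sentCount_add, ih, load, arcLoad,
      ptr_evol_add G ord S0 t i _ ((G.degree_pos_iff_exists_adj _).2 ⟨d.snd, d.adj⟩)]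

lemma cum_eq_or (S0 : State G) (t i : ℕ) (d : G.Dart) :
    cum G ord S0 t (t + i) d = cumV G ord S0 t (t + i) d.fst / G.degree d.fst ∨
      cum G ord S0 t (t + i) d = cumV G ord S0 t (t + i) d.fst / G.degree d.fst + 1 := by
  rw [cum_eq_sentCount]
  exact sentCount_eq_or _ _ _ _ (Fin.is_lt _)

/-- In one step every vertex that has a neighbour sends out all of its tokens. -/
lemma sum_arcLoad_outArcs (S : State G) (v : V) (hv : 0 < G.degree v) :
    ∑ d ∈ outArcs G v, arcLoad G ord S d = S.tokens v := by
  have h : ∀ x : {d : G.Dart // d.fst = v}, arcLoad G ord S x =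
      sentCount (G.degree v) (S.ptr v) (S.tokens v) ((ord v).symm x : Fin (G.degree v)) := by
    rintro ⟨d, rfl⟩
    rfl
  rw [← sum_sentCount (G.degree v) (S.ptr v) (S.tokens v) hv,
    ← Equiv.sum_comp (ord v).symm, outArcs,
    Finset.sum_subtype (p := fun d : G.Dart => d.fst = v) _ (by simp)]
  exact Finset.sum_congr rfl fun x _ => h x

/-- Tokens received by `v` during a time interval are sent out one step later. -/
lemma sum_cum_outArcs (S0 : State G) (t i : ℕ) (v : V) :
    ∑ d ∈ outArcs G v, cum G ord S0 (t + 1) (t + 1 + i) d =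
      ∑ d ∈ inArcs G v, cum G ord S0 t (t + i) d := by
  rcases Nat.eq_zero_or_pos (G.degree v) with hv | hv
  · have hadj : ∀ w, ¬ G.Adj v w := fun w hw =>
      hv.not_gt ((G.degree_pos_iff_exists_adj v).2 ⟨w, hw⟩)
    have hout : outArcs G v = ∅ :=
      Finset.filter_eq_empty_iff.2 fun d _ h => hadj d.snd (h ▸ d.adj)
    have hin : inArcs G v = ∅ :=
      Finset.filter_eq_empty_iff.2 fun d _ h => hadj d.fst (h ▸ d.adj.symm)
    rw [hout, hin, Finset.sum_empty, Finset.sum_empty]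
  · simp only [cum]
    rw [Finset.sum_comm, Finset.sum_comm (s := inArcs G v), add_right_comm,
      ← Finset.sum_Ico_add']
    refine Finset.sum_congr rfl fun s _ => ?_
    simp only [load]
    rw [sum_arcLoad_outArcs G ord _ v hv, evol_succ]
    simp [step, hv.ne']

/-- In any rotor-router execution, for every `i ≥ 0` and every time `t`,
the `i`-th potential is non-increasing: `Φ_i(S_{t+1}) ≤ Φ_i(S_t)`. -/
theorem potential_nonincreasing (hconn : G.Connected) (S0 : State G) (i t : ℕ) :
    pot G ord S0 i (t + 1) ≤ pot G ord S0 i t := by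
  set q : V → ℤ := fun v => ((cumV G ord S0 (t + 1) (t + 1 + i) v / G.degree v : ℕ) : ℤ)
    with hq
  set x : G.Dart → ℤ := fun d => (cum G ord S0 (t + 1) (t + 1 + i) d : ℤ) with hx
  set y : G.Dart → ℤ := fun d => (cum G ord S0 t (t + i) d : ℤ) with hy
  have hsymm : ∑ d : G.Dart, q d.fst * (q d.fst + 1) = ∑ d : G.Dart, q d.snd * (q d.snd + 1) :=
    (Equiv.sum_comp (Function.Involutive.toPerm _ SimpleGraph.Dart.symm_involutive)
      fun d : G.Dart => q d.fst * (q d.fst + 1)).symm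
  have hlin : ∑ d, (2 * q d.fst + 1) * x d = ∑ d, (2 * q d.snd + 1) * y d := by
    rw [← Finset.sum_fiberwise _ (fun d : G.Dart => d.fst),
      ← Finset.sum_fiberwise _ (fun d : G.Dart => d.snd)]
    refine Finset.sum_congr rfl fun v _ => ?_
    have hflow : ∑ d with d.fst = v, x d = ∑ d with d.snd = v, y d := by
      simp only [hx, hy]
      exact_mod_cast sum_cum_outArcs G ord S0 t i v
    calc ∑ d with d.fst = v, (2 * q d.fst + 1) * x d
        = (2 * q v + 1) * ∑ d with d.fst = v, x d := by
          rw [Finset.mul_sum]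
          refine Finset.sum_congr rfl fun d hd => ?_
          rw [(Finset.mem_filter.1 hd).2]
      _ = ∑ d with d.snd = v, (2 * q d.snd + 1) * y d := by
          rw [hflow, Finset.mul_sum]
          refine Finset.sum_congr rfl fun d hd => ?_
          rw [(Finset.mem_filter.1 hd).2]
  have hout : ∀ d, x d ^ 2 = (2 * q d.fst + 1) * x d - q d.fst * (q d.fst + 1) := by
    intro d
    have h : x d = q d.fst ∨ x d = q d.fst + 1 := by
      simp only [hx, hq]
      exact_mod_cast cum_eq_or G ord S0 (t + 1) i d
    rcases h with h | h <;> rw [h] <;> ring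
  have hin : ∀ d, (2 * q d.snd + 1) * y d - q d.snd * (q d.snd + 1) ≤ y d ^ 2 := by
    intro d
    rcases le_or_gt (y d) (q d.snd) with h | h
    · nlinarith
    · nlinarith [Int.add_one_le_iff.2 h]
  have hsum : ∑ d, x d ^ 2 ≤ ∑ d, y d ^ 2 := by
    refine le_trans (le_of_eq ?_) (Finset.sum_le_sum fun d _ => hin d)
    rw [Finset.sum_congr rfl fun d _ => hout d, Finset.sum_sub_distrib,
      Finset.sum_sub_distrib, hlin, hsymm]
  simp only [hx, hy] at hsum
  unfold pot
  exact_mod_cast hsum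

end RotorRouter
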